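/- Reduction of the involution problem to matrix form: Let α ∈ ℂ with α² ≠ 1, p, q ∈ L¹(−1,1), λ ∈ ℂ, and let u be a solution of the functional-differential equation with involution −αu''(x) − u''(−x) + p(x)u(x) + q(x)u(−x) = λu(x) on (−1,1) satisfying u(−1) = u(1) = 0. Define Z(x) := (u(−x), u(x))ᵀ for x ∈ [0,1]. Then Z is continuously differentiable on [0,1] with Z' absolutely continuous, Z satisfies −Z''(x) + 𝒬(x)Z(x) = λ·𝒲·Z(x) for almost every x ∈ (0,1), and Z satisfies the boundary conditions 𝒯Z'(0) + 𝒯^⊥Z(0) = 0 and Z(1) = 0. -/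

import Mathlib

open MeasureTheory Set Matrix Complex intervalIntegral

noncomputable section

abbrev M2 : Type := Matrix (Fin 2) (Fin 2) ℂ

/-- The weight matrix `𝒲 = [[α,1],[1,α]]⁻¹`. -/
def MatW (α : ℂ) : M2 := (!![α, 1; 1, α])⁻¹

/-- The matrix potential `𝒬(x) = 𝒲 [[p(-x), q(-x)],[q(x), p(x)]]`. -/
def MatQ (α : ℂ) (p q : ℝ → ℂ) (x : ℝ) : M2 := MatW α * !![p (-x), q (-x); q x, p x]

/-- The projector `𝒯 = (1/2) [[1,1],[1,1]]`. -/
def MatT : M2 := (2:ℂ)⁻¹ • !![1, 1; 1, 1]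

/-- The system with matrix `[[α,1],[1,α]]` is solved by applying `𝒲`. -/
theorem eq_matW_mulVec {α : ℂ} (hα : α ^ 2 ≠ 1) {v w : Fin 2 → ℂ}
    (h : !![α, 1; 1, α] *ᵥ v = w) : v = MatW α *ᵥ w := by
  have hdet : IsUnit (!![α, 1; 1, α] : M2).det := by
    rw [Matrix.det_fin_two_of, isUnit_iff_ne_zero, one_mul, ← sq]
    exact sub_ne_zero.mpr hα
  rw [← h, MatW, Matrix.mulVec_mulVec, Matrix.nonsing_inv_mul _ hdet, Matrix.one_mulVec]

/-- A property holding almost everywhere on `(-1, 1)` also holds almost everywhere there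
after reflection. -/
theorem ae_restrict_Ioo_comp_neg {P : ℝ → Prop}
    (h : ∀ᵐ x ∂(volume.restrict (Ioo (-1:ℝ) 1)), P x) :
    ∀ᵐ x ∂(volume.restrict (Ioo (-1:ℝ) 1)), P (-x) := by
  rw [ae_restrict_iff' measurableSet_Ioo] at h ⊢
  have h' := (Measure.measurePreserving_neg (volume : Measure ℝ)).quasiMeasurePreserving.ae h
  filter_upwards [h'] with x hx hmem
  exact hx ⟨by linarith [hmem.2], by linarith [hmem.1]⟩

/-- Reduction of the boundary value problem for the functional-differential equation with
involution `-α u''(x) - u''(-x) + p(x) u(x) + q(x) u(-x) = λ u(x)`, `u(±1) = 0`, to the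
matrix form: `Z(x) = (u(-x), u(x))ᵀ` is continuously differentiable on `[0,1]` with
absolutely continuous derivative, satisfies `-Z'' + 𝒬(x) Z = λ 𝒲 Z` a.e. on `(0,1)`
(expressed by the integral identity for `Z'`), and satisfies the boundary conditions
`𝒯 Z'(0) + 𝒯^⊥ Z(0) = 0`, `Z(1) = 0`. -/
theorem stmt_13
    (α : ℂ) (hα : α ^ 2 ≠ 1)
    (p q : ℝ → ℂ) (hp : IntegrableOn p (Ioo (-1) 1)) (hq : IntegrableOn q (Ioo (-1) 1))
    (lam : ℂ) (u u' u'' : ℝ → ℂ)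
    (hud : ∀ x ∈ Icc (-1:ℝ) 1, HasDerivWithinAt u (u' x) (Icc (-1:ℝ) 1) x)
    (hu'c : ContinuousOn u' (Icc (-1:ℝ) 1))
    (hu'' : IntegrableOn u'' (Ioo (-1) 1))
    (huac : ∀ x ∈ Icc (-1:ℝ) 1, u' x = u' (-1) + ∫ t in (-1:ℝ)..x, u'' t)
    (heq : ∀ᵐ x ∂(volume.restrict (Ioo (-1:ℝ) 1)),
      -α * u'' x - u'' (-x) + p x * u x + q x * u (-x) = lam * u x)
    (hbc : u (-1) = 0 ∧ u 1 = 0)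
    (Z : ℝ → Fin 2 → ℂ) (hZ : ∀ x, Z x = ![u (-x), u x]) :
    ∃ Zd : ℝ → Fin 2 → ℂ,
      (∀ x ∈ Icc (0:ℝ) 1, HasDerivWithinAt Z (Zd x) (Icc (0:ℝ) 1) x) ∧
      ContinuousOn Zd (Icc (0:ℝ) 1) ∧
      (∀ x ∈ Icc (0:ℝ) 1, Zd x = Zd 0 +
        ∫ t in (0:ℝ)..x, ((MatQ α p q t).mulVec (Z t) - lam • (MatW α).mulVec (Z t))) ∧
      MatT.mulVec (Zd 0) + (1 - MatT).mulVec (Z 0) = 0 ∧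
      Z 1 = 0 := by
  have hcIcc : ∀ {x : ℝ}, x ∈ Icc (0:ℝ) 1 → x ∈ Icc (-1:ℝ) 1 := fun hx ↦
    ⟨by linarith [hx.1], hx.2⟩
  have hnIcc : ∀ {x : ℝ}, x ∈ Icc (0:ℝ) 1 → -x ∈ Icc (-1:ℝ) 1 := fun hx ↦
    ⟨by linarith [hx.2], by linarith [hx.1]⟩
  have hint : IntervalIntegrable u'' volume (-1) 1 :=
    (intervalIntegrable_iff_integrableOn_Ioo_of_le (by norm_num)).2 hu''
  have hsub : ∀ {a b : ℝ}, a ∈ Icc (-1:ℝ) 1 → b ∈ Icc (-1:ℝ) 1 →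
      IntervalIntegrable u'' volume a b := fun ha hb ↦
    hint.mono_set (uIcc_subset_uIcc (by rwa [uIcc_of_le (by norm_num)])
      (by rwa [uIcc_of_le (by norm_num)]))
  have h0 : (0:ℝ) ∈ Icc (-1:ℝ) 1 := by norm_num
  have hm1 : (-1:ℝ) ∈ Icc (-1:ℝ) 1 := by norm_num
  have hFTC : ∀ {x : ℝ}, x ∈ Icc (-1:ℝ) 1 → u' x = u' 0 + ∫ t in (0:ℝ)..x, u'' t := by
    intro x hx
    rw [huac x hx, huac 0 h0, add_assoc,
      integral_add_adjacent_intervals (hsub hm1 h0) (hsub h0 hx)]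
  have hZ'' : ∀ᵐ t ∂(volume.restrict (Ioo (-1:ℝ) 1)),
      ![u'' (-t), u'' t] = (MatQ α p q t) *ᵥ (Z t) - lam • (MatW α) *ᵥ (Z t) := by
    filter_upwards [heq, ae_restrict_Ioo_comp_neg heq] with t h₁ h₂
    rw [neg_neg] at h₂
    rw [MatQ, ← Matrix.mulVec_mulVec, ← Matrix.mulVec_smul, ← Matrix.mulVec_sub]
    apply eq_matW_mulVec hα
    rw [hZ]
    ext i
    fin_cases i
    · simp [Matrix.mulVec, dotProduct, Fin.sum_univ_two]
      linear_combination -h₂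
    · simp [Matrix.mulVec, dotProduct, Fin.sum_univ_two]
      linear_combination -h₁
  refine ⟨fun x ↦ ![-u' (-x), u' x], fun x hx ↦ ?_, ?_, fun x hx ↦ ?_, ?_, ?_⟩
  · rw [hasDerivWithinAt_pi]
    intro i
    fin_cases i
    · simpa [hZ, Function.comp_def] using (hud (-x) (hnIcc hx)).scomp x
        (hasDerivAt_neg x).hasDerivWithinAt (fun y hy ↦ hnIcc hy)
    · simpa [hZ] using (hud x (hcIcc hx)).mono fun y hy ↦ hcIcc hy
  · rw [continuousOn_pi]
    intro i
    fin_cases i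
    · exact (hu'c.comp continuous_neg.continuousOn fun y hy ↦ hnIcc hy).neg
    · simpa using hu'c.mono fun y hy ↦ hcIcc hy
  · have hcongr : ∫ t in (0:ℝ)..x, ((MatQ α p q t) *ᵥ (Z t) - lam • (MatW α) *ᵥ (Z t)) =
        ∫ t in (0:ℝ)..x, ![u'' (-t), u'' t] := by
      rw [integral_of_le hx.1, integral_of_le hx.1, integral_Ioc_eq_integral_Ioo,
        integral_Ioc_eq_integral_Ioo]
      refine integral_congr_ae ((ae_restrict_of_ae_restrict_of_subset
        (Ioo_subset_Ioo (by norm_num) hx.2) hZ'').mono fun t ht ↦ ht.symm)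
    have hi₁ : IntervalIntegrable (fun t ↦ u'' (-t)) volume 0 x := by
      simpa using (IntervalIntegrable.iff_comp_neg (f := u'')).1 (hsub h0 (hnIcc hx))
    have hi₂ := hsub h0 (hcIcc hx)
    have hi : IntervalIntegrable (fun t ↦ ![u'' (-t), u'' t]) volume 0 x := by
      rw [intervalIntegrable_iff] at hi₁ hi₂ ⊢
      refine Integrable.of_eval fun i ↦ ?_
      fin_cases i
      · exact hi₁
      · exact hi₂
    rw [hcongr]
    ext i
    have hproj := (ContinuousLinearMap.proj (R := ℂ) (φ := fun _ : Fin 2 ↦ ℂ)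
      i).intervalIntegral_comp_comm hi
    simp only [ContinuousLinearMap.proj_apply] at hproj
    rw [Pi.add_apply, ← hproj]
    fin_cases i
    · simp [hFTC (hnIcc hx), integral_symm (-x), add_comm]
    · simpa using hFTC (hcIcc hx)
  · ext i
    fin_cases i <;> simp [MatT, hZ] <;> ring
  · ext i
    fin_cases i <;> simp [hZ, hbc.1, hbc.2]
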